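/- (Lemma 1) Let J and N be finite nilpotent groups with J acting on N by automorphisms. Then the map φ ↦ (φ|_{J_p})_{p ∈ D} induces an isomorphism of pointed sets H¹(J, N) ≅ ∏_{p ∈ D} H¹(J_p, N)^{J'_p}, where D is the set of primes dividing both |J| and |N|, J_p is the Sylow p-subgroup of J, and J'_p is its Hall p'-subgroup. -/

import Mathlib

section

variable {N J : Type*} [Group N] [Group J] (φ : J →* MulAut N)

/-- Crossed homomorphisms `J → N`. -/
def CrossedHom : Type _ := {f : J → N // ∀ j j', f (j * j') = f j * φ j (f j')}

/-- The cohomology relation on raw functions. -/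
def Cohomologous (f g : J → N) : Prop :=
  ∃ n : N, ∀ j, g j = n⁻¹ * f j * φ j n

/-- The cohomology relation on crossed homomorphisms. -/
def cohRel (f g : CrossedHom φ) : Prop := Cohomologous φ f.1 g.1

end

open MulAction

section PrimaryProjection

variable {G : Type*} [Group G] [Finite G] [Group.IsNilpotent G]

/-- In a finite nilpotent group the projection onto the `q`-primary component is a power map. -/
theorem exists_primaryProj (G : Type*) [Group G] [Finite G] [Group.IsNilpotent G] {q : ℕ}
    (hq : q.Prime) :
    ∃ π : G →* G, (∃ e : ℕ, ∀ x, π x = x ^ e) ∧ (∃ k : ℕ, ∀ x, π x ^ q ^ k = 1) ∧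
      ∀ (x : G) (k : ℕ), x ^ q ^ k = 1 → π x = x := by
  obtain ⟨a, b, hb, hab⟩ := Nat.exists_eq_pow_mul_and_not_dvd (Nat.card_pos (α := G)).ne' q hq.ne_one
  have hcop : (q ^ a).Coprime b := Nat.Coprime.pow_left _ ((Nat.Prime.coprime_iff_not_dvd hq).2 hb)
  obtain ⟨e, he1, he0⟩ := Nat.chineseRemainder hcop 1 0
  have hbe : b ∣ e := (Nat.modEq_zero_iff_dvd).1 he0
  have hfix : ∀ (x : G) (k : ℕ), x ^ q ^ k = 1 → x ^ e = x := by
    intro x k hx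
    have h1 : orderOf x ∣ q ^ k := orderOf_dvd_of_pow_eq_one hx
    have h2 : orderOf x ∣ q ^ a * b := hab ▸ orderOf_dvd_natCard x
    have h3 : (orderOf x).Coprime b := Nat.Coprime.coprime_dvd_left h1
      (Nat.Coprime.pow_left _ ((Nat.Prime.coprime_iff_not_dvd hq).2 hb))
    have h4 : orderOf x ∣ q ^ a := h3.dvd_of_dvd_mul_right h2
    conv_rhs => rw [← pow_one x]
    exact pow_eq_pow_iff_modEq.2 (he1.of_dvd h4)
  have htriv : ∀ (x : G) (r k : ℕ), r.Prime → r ≠ q → x ^ r ^ k = 1 → x ^ e = 1 := by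
    intro x r k hr hrq hx
    have h1 : orderOf x ∣ r ^ k := orderOf_dvd_of_pow_eq_one hx
    have h2 : orderOf x ∣ q ^ a * b := hab ▸ orderOf_dvd_natCard x
    have h3 : (orderOf x).Coprime (q ^ a) := Nat.Coprime.coprime_dvd_left h1
      (Nat.coprime_pow_primes _ _ hr hq hrq)
    exact orderOf_dvd_iff_pow_eq_one.1 ((h3.dvd_of_dvd_mul_left h2).trans hbe)
  obtain ⟨E⟩ := ((Group.isNilpotent_of_finite_tfae (G := G)).out 0 4).mp ‹_›
  have hmul : ∀ x y : G, (x * y) ^ e = x ^ e * y ^ e := by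
    intro x y
    obtain ⟨u, rfl⟩ := E.surjective x
    obtain ⟨v, rfl⟩ := E.surjective y
    rw [← map_mul, ← map_pow, ← map_pow, ← map_pow, ← map_mul]
    congr 1
    funext r P
    have hr : (r : ℕ).Prime := Nat.prime_of_mem_primeFactors r.2
    have hpow : ∀ z : P, ∃ k : ℕ, (z : G) ^ (r : ℕ) ^ k = 1 := fun z => by
      obtain ⟨k, hk⟩ := P.isPGroup' z
      exact ⟨k, by simpa using congrArg Subtype.val hk⟩
    simp only [Pi.mul_apply, Pi.pow_apply]
    apply Subtype.ext
    simp only [Subgroup.coe_mul, SubmonoidClass.coe_pow]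
    rw [← Subgroup.coe_mul]
    obtain ⟨k1, h1⟩ := hpow (u r P)
    obtain ⟨k2, h2⟩ := hpow (v r P)
    obtain ⟨k3, h3⟩ := hpow (u r P * v r P)
    by_cases hrq : (r : ℕ) = q
    · have h (z : G) (k : ℕ) (hz : z ^ (r : ℕ) ^ k = 1) : z ^ e = z := hfix z k (hrq ▸ hz)
      rw [h _ _ h1, h _ _ h2, h _ _ h3, Subgroup.coe_mul]
    · rw [htriv _ _ _ hr hrq h1, htriv _ _ _ hr hrq h2, htriv _ _ _ hr hrq h3, one_mul]
  refine ⟨MonoidHom.mk' (fun x => x ^ e) hmul, ⟨e, fun x => rfl⟩, ⟨a, fun x => ?_⟩, hfix⟩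
  change (x ^ e) ^ q ^ a = 1
  rw [← pow_mul]
  refine orderOf_dvd_iff_pow_eq_one.1 ((orderOf_dvd_natCard x).trans ?_)
  rw [hab, mul_comm]
  exact Nat.mul_dvd_mul_right hbe _

open Classical in
/-- The projection of a finite nilpotent group onto its `q`-primary component, for `q` prime. -/
noncomputable def primaryProj (G : Type*) [Group G] [Finite G] [Group.IsNilpotent G] (q : ℕ) :
    G →* G :=
  if hq : q.Prime then (exists_primaryProj G hq).choose else 1

theorem primaryProj_spec {q : ℕ} (hq : q.Prime) :
    (∃ e : ℕ, ∀ x, primaryProj G q x = x ^ e) ∧ (∃ k : ℕ, ∀ x, primaryProj G q x ^ q ^ k = 1) ∧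
      ∀ (x : G) (k : ℕ), x ^ q ^ k = 1 → primaryProj G q x = x := by
  rw [primaryProj, dif_pos hq]
  exact (exists_primaryProj G hq).choose_spec

theorem primaryProj_of_pow_eq_one {q : ℕ} (hq : q.Prime) {x : G} {k : ℕ} (hx : x ^ q ^ k = 1) :
    primaryProj G q x = x :=
  (primaryProj_spec hq).2.2 x k hx

theorem primaryProj_idem {q : ℕ} (hq : q.Prime) (x : G) :
    primaryProj G q (primaryProj G q x) = primaryProj G q x := by
  obtain ⟨k, hk⟩ := (primaryProj_spec (G := G) hq).2.1
  exact primaryProj_of_pow_eq_one hq (hk x)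

theorem primaryProj_eq_one_of_coprime {q : ℕ} (hq : q.Prime) {x : G}
    (hx : (orderOf x).Coprime q) : primaryProj G q x = 1 := by
  obtain ⟨k, hk⟩ := (primaryProj_spec (G := G) hq).2.1
  have h1 : orderOf (primaryProj G q x) ∣ q ^ k := orderOf_dvd_of_pow_eq_one (hk x)
  exact orderOf_eq_one_iff.1
    (Nat.eq_one_of_dvd_coprimes (hx.pow_right k) (orderOf_map_dvd _ x) h1)

theorem primaryProj_map (q : ℕ) (ψ : MulAut G) (x : G) :
    primaryProj G q (ψ x) = ψ (primaryProj G q x) := by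
  by_cases hq : q.Prime
  · obtain ⟨e, he⟩ := (primaryProj_spec (G := G) hq).1
    rw [he, he, map_pow]
  · simp [primaryProj, hq]

theorem isPGroup_range_primaryProj {q : ℕ} (hq : q.Prime) :
    IsPGroup q (primaryProj G q).range := by
  obtain ⟨k, hk⟩ := (primaryProj_spec (G := G) hq).2.1
  rintro ⟨_, x, rfl⟩
  exact ⟨k, Subtype.ext (by simpa using hk x)⟩

theorem eq_one_of_primaryProj_eq_one {x : G}
    (hx : ∀ q : ℕ, q.Prime → q ∣ Nat.card G → primaryProj G q x = 1) : x = 1 := by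
  by_contra hne
  obtain ⟨q, hq, hqx⟩ := Nat.exists_prime_and_dvd (mt orderOf_eq_one_iff.1 hne)
  have hord : orderOf (x ^ (orderOf x / q)) = q :=
    orderOf_pow_orderOf_div (orderOf_pos x).ne' hqx
  have h1 : primaryProj G q (x ^ (orderOf x / q)) = x ^ (orderOf x / q) :=
    primaryProj_of_pow_eq_one hq (k := 1) (by
      rw [pow_one]; exact orderOf_dvd_iff_pow_eq_one.1 hord.dvd)
  rw [map_pow, hx q hq (hqx.trans (orderOf_dvd_natCard x)), one_pow] at h1
  rw [← h1, orderOf_one] at hord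
  exact hq.one_lt.ne hord

theorem eq_of_primaryProj_eq {x y : G}
    (h : ∀ q : ℕ, q.Prime → q ∣ Nat.card G → primaryProj G q x = primaryProj G q y) : x = y := by
  rw [← mul_inv_eq_one]
  refine eq_one_of_primaryProj_eq_one fun q hq hqG => ?_
  rw [map_mul, map_inv, h q hq hqG, mul_inv_cancel]

theorem exists_primaryProj_eq (m : ℕ → G) :
    ∃ x : G, ∀ q : ℕ, q.Prime → q ∣ Nat.card G →
      primaryProj G q x = primaryProj G q (m q) := by
  have key : ∀ S : Finset ℕ, (∀ q ∈ S, q.Prime) → ∃ x : G, ∀ q : ℕ, q.Prime →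
      primaryProj G q x = if q ∈ S then primaryProj G q (m q) else 1 := by
    intro S
    induction S using Finset.induction_on with
    | empty => exact fun _ => ⟨1, by simp⟩
    | insert r S hr ih =>
      intro hS
      have hrp : r.Prime := hS r (Finset.mem_insert_self _ _)
      obtain ⟨x, hx⟩ := ih fun q hq => hS q (Finset.mem_insert_of_mem hq)
      refine ⟨x * primaryProj G r (m r), fun q hq => ?_⟩
      rw [map_mul, hx q hq]
      by_cases hqr : q = r
      · subst hqr
        simp [hr, primaryProj_idem hq]
      · have : primaryProj G q (primaryProj G r (m r)) = 1 := by
          obtain ⟨k, hk⟩ := (primaryProj_spec (G := G) hrp).2.1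
          refine primaryProj_eq_one_of_coprime hq ?_
          exact Nat.Coprime.coprime_dvd_left (orderOf_dvd_of_pow_eq_one (hk _))
            (Nat.Coprime.pow_left _ ((Nat.coprime_primes hrp hq).2 (Ne.symm hqr)))
        simp [this, hqr]
  obtain ⟨x, hx⟩ := key (Nat.card G).primeFactors fun q hq => Nat.prime_of_mem_primeFactors hq
  refine ⟨x, fun q hq hqG => ?_⟩
  rw [hx q hq, if_pos (Nat.mem_primeFactors.2 ⟨hq, hqG, Nat.card_pos.ne'⟩)]

theorem mem_sylow_iff_primaryProj_eq {q : ℕ} [hq : Fact q.Prime] (P : Sylow q G) {x : G} :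
    x ∈ P ↔ primaryProj G q x = x := by
  have hle : (P : Subgroup G) ≤ (primaryProj G q).range := fun y hy => by
    obtain ⟨k, hk⟩ := P.isPGroup' ⟨y, hy⟩
    exact ⟨y, primaryProj_of_pow_eq_one hq.out (k := k) (by simpa using congrArg Subtype.val hk)⟩
  have heq := P.is_maximal' (isPGroup_range_primaryProj hq.out) hle
  change x ∈ (P : Subgroup G) ↔ _
  rw [← heq]
  constructor
  · rintro ⟨y, rfl⟩
    exact primaryProj_idem hq.out y
  · exact fun h => ⟨x, h⟩

theorem commute_of_primaryProj {q : ℕ} (hq : q.Prime) {x y : G}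
    (hx : primaryProj G q x = x) (hy : primaryProj G q y = 1) : Commute x y := by
  have : Fact q.Prime := ⟨hq⟩
  let P : Sylow q G := default
  have hP : (P : Subgroup G).Normal := inferInstance
  have h1 : x * (y * x⁻¹ * y⁻¹) ∈ P :=
    mul_mem ((mem_sylow_iff_primaryProj_eq P).2 hx)
      (hP.conj_mem _ (inv_mem ((mem_sylow_iff_primaryProj_eq P).2 hx)) y)
  have h2 := (mem_sylow_iff_primaryProj_eq P).1 h1
  simp only [map_mul, map_inv, hx, hy] at h2
  have h3 : x * y * x⁻¹ * y⁻¹ = 1 := by simpa [mul_assoc] using h2.symm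
  rw [mul_inv_eq_one, mul_inv_eq_iff_eq_mul] at h3
  exact h3

theorem not_dvd_card_ker_primaryProj {q : ℕ} (hq : q.Prime) :
    ¬ q ∣ Nat.card (primaryProj G q).ker := by
  have : Fact q.Prime := ⟨hq⟩
  intro h
  obtain ⟨⟨y, hy⟩, hord⟩ := exists_prime_orderOf_dvd_card' q h
  rw [Subgroup.orderOf_mk] at hord
  have h1 : primaryProj G q y = y := primaryProj_of_pow_eq_one hq (k := 1) (by
    rw [pow_one]; exact orderOf_dvd_iff_pow_eq_one.1 hord.dvd)
  rw [MonoidHom.mem_ker.1 hy] at h1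
  rw [← h1, orderOf_one] at hord
  exact hq.one_lt.ne hord

end PrimaryProjection

section FixedPoints

/-- If the fixed-point sets of normal subgroups of a finite nilpotent group `A` have `q`-power
size, then fixed points of a normal subgroup of index prime to `q` force fixed points of `A`. -/
theorem fixedPoints_nonempty_of_normal {A X : Type*} [Group A] [Finite A] [Group.IsNilpotent A]
    [MulAction A X] {q : ℕ} (hq : q.Prime) (Q : Subgroup A) [hQ : Q.Normal]
    (hQi : ¬ q ∣ Q.index) (hQX : (fixedPoints Q X).Nonempty)
    (hcard : ∀ K : Subgroup A, (fixedPoints K X).Nonempty →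
      ∃ k : ℕ, Nat.card (fixedPoints K X) ∣ q ^ k) :
    (fixedPoints A X).Nonempty := by
  have hfin : {K : Subgroup A | K.Normal ∧ ¬ q ∣ K.index ∧ (fixedPoints K X).Nonempty}.Finite :=
    Set.toFinite _
  obtain ⟨K, ⟨hKn, hKi, hKX⟩, hmax⟩ := hfin.exists_maximal ⟨Q, hQ, hQi, hQX⟩
  have htop : K = ⊤ := by
    by_contra hne
    obtain ⟨r, hr, hrK⟩ := Nat.exists_prime_and_dvd (mt Subgroup.index_eq_one.1 hne)
    have hrF : Fact r.Prime := ⟨hr⟩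
    have hrq : r ≠ q := by rintro rfl; exact hKi hrK
    let R : Sylow r A := default
    have hR : (R : Subgroup A).Normal := inferInstance
    have hRK : ¬ (R : Subgroup A) ≤ K := fun h =>
      R.not_dvd_index (hrK.trans (Subgroup.index_dvd_of_le h))
    let act : MulAction R (fixedPoints K X) :=
      { smul := fun g x => ⟨(g : A) • (x : X), fun k => by
          have h := x.2 ⟨(g : A)⁻¹ * k * g, by
            simpa using hKn.conj_mem k k.2 (g : A)⁻¹⟩
          change (k : A) • (g : A) • (x : X) = (g : A) • (x : X)
          change ((g : A)⁻¹ * k * g) • (x : X) = x at h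
          conv_rhs => rw [← h]
          simp [smul_smul, mul_assoc]⟩
        one_smul := fun x => Subtype.ext (one_smul A (x : X))
        mul_smul := fun g h x => Subtype.ext (mul_smul (g : A) (h : A) (x : X)) }
    have hndvd : ¬ r ∣ Nat.card (fixedPoints K X) := fun h => by
      obtain ⟨k, hk⟩ := hcard K hKX
      exact hrq ((Nat.prime_dvd_prime_iff_eq hr hq).1 (hr.dvd_of_dvd_pow (h.trans hk)))
    obtain ⟨x, hx⟩ := R.isPGroup'.nonempty_fixed_point_of_prime_not_dvd_card _ hndvd
    have hle : K ⊔ R ≤ stabilizer A (x : X) :=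
      sup_le (fun k hk => x.2 ⟨k, hk⟩) fun g hg => congrArg Subtype.val (hx ⟨g, hg⟩)
    have := hmax (y := K ⊔ R) ⟨inferInstance,
      fun h => hKi (h.trans (Subgroup.index_dvd_of_le le_sup_left)),
      ⟨x, fun k => hle k.2⟩⟩ le_sup_left
    exact hRK (le_sup_right.trans this)
  obtain ⟨x, hx⟩ := hKX
  exact ⟨x, fun a => hx ⟨a, htop ▸ Subgroup.mem_top a⟩⟩

/-- For a group `A` acting compatibly on a group `M` and an `M`-torsor `T`, the number of fixed
points in `T` divides the order of `M`. -/
theorem card_fixedPoints_dvd_of_torsor {A T M : Type*} [Group A] [MulAction A T] [Group M]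
    (β : A → M →* M) (op : T → M → T) (hop : ∀ t, Function.Bijective (op t))
    (hβ : ∀ a t m, a • op t m = op (a • t) (β a m)) {t₀ : T} (ht₀ : t₀ ∈ fixedPoints A T) :
    Nat.card (fixedPoints A T) ∣ Nat.card M := by
  let S : Subgroup M := ⨅ a, (β a).eqLocus (MonoidHom.id M)
  have hS : ∀ m, m ∈ S ↔ ∀ a, β a m = m := fun m => by simp [S, Subgroup.mem_iInf]; rfl
  have hmem : ∀ m, m ∈ S ↔ op t₀ m ∈ fixedPoints A T := fun m => by
    rw [hS, mem_fixedPoints]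
    refine forall_congr' fun a => ?_
    rw [hβ, ht₀ a, (hop t₀).1.eq_iff]
  have : Nat.card S = Nat.card (fixedPoints A T) :=
    Nat.card_congr ((Equiv.ofBijective _ (hop t₀)).subtypeEquiv hmem)
  rw [← this]
  exact S.card_subgroup_dvd_card

theorem fixedPoints_nonempty_of_torsor {A T M : Type*} [Group A] [Finite A]
    [Group.IsNilpotent A] [MulAction A T] [Group M] [Finite M] {q : ℕ} (hq : q.Prime)
    (hM : IsPGroup q M) (β : A → M →* M) (op : T → M → T) (hop : ∀ t, Function.Bijective (op t))
    (hβ : ∀ a t m, a • op t m = op (a • t) (β a m))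
    (Q : Subgroup A) [Q.Normal] (hQi : ¬ q ∣ Q.index) (hQT : (fixedPoints Q T).Nonempty) :
    (fixedPoints A T).Nonempty := by
  have : Fact q.Prime := ⟨hq⟩
  refine fixedPoints_nonempty_of_normal hq Q hQi hQT fun K ⟨t, ht⟩ => ?_
  obtain ⟨k, hk⟩ := IsPGroup.iff_card.1 hM
  exact ⟨k, hk ▸ card_fixedPoints_dvd_of_torsor (fun a : K => β a) op hop
    (fun a => hβ a) ht⟩

/-- Glauberman's lemma, transitivity part: fixed points of a coprime action are conjugate under
the fixed points of the acting `q`-group. -/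
theorem exists_fixed_smul_eq {A X M : Type*} [Group A] [Finite A] [Group.IsNilpotent A]
    [MulAction A X] [Group M] [Finite M] [MulAction M X] [IsPretransitive M X]
    {q : ℕ} (hq : q.Prime) (hM : IsPGroup q M) (hA : ¬ q ∣ Nat.card A) (α : A →* MulAut M)
    (hα : ∀ (a : A) (m : M) (x : X), a • m • x = α a m • a • x) {x y : X}
    (hx : x ∈ fixedPoints A X) (hy : y ∈ fixedPoints A X) :
    ∃ m : M, (∀ a, α a m = m) ∧ m • x = y := by
  let act : MulAction A {m : M // m • x = y} :=
    { smul := fun a m => ⟨α a m, by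
          have h := hα a m x
          rw [m.2, hx a, hy a] at h
          exact h.symm⟩
      one_smul := fun m => Subtype.ext (by change α 1 (m : M) = m; simp)
      mul_smul := fun a b m => Subtype.ext (by
        change α (a * b) (m : M) = α a (α b (m : M)); simp) }
  have hstab : ∀ (a : A) (s : stabilizer M x), α a s ∈ stabilizer M x := fun a s => by
    have h := hα a s x
    rw [s.2, hx a] at h
    exact h.symm
  obtain ⟨m₀, hm₀⟩ := exists_smul_eq M x y
  obtain ⟨m, hm⟩ := fixedPoints_nonempty_of_torsor (A := A) (T := {m : M // m • x = y})
    (M := stabilizer M x) hq (hM.to_subgroup _)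
    (fun a => ((α a).toMonoidHom.comp (stabilizer M x).subtype).codRestrict _ (hstab a))
    (fun t s => ⟨t * s, by rw [mul_smul, s.2, t.2]⟩)
    (fun t => ⟨fun s s' h => Subtype.ext (mul_left_cancel (congrArg Subtype.val h)),
      fun t' => ⟨⟨(t : M)⁻¹ * t', by
        rw [mem_stabilizer_iff, mul_smul, t'.2, inv_smul_eq_iff, t.2]⟩,
        Subtype.ext (mul_inv_cancel_left _ _)⟩⟩)
    (fun a t s => Subtype.ext (map_mul (α a) (t : M) (s : M)))
    ⊥ (by rwa [Subgroup.index_bot]) ⟨⟨m₀, hm₀⟩, fun b => by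
      obtain ⟨b, hb⟩ := b
      rw [Subgroup.mem_bot] at hb
      subst hb
      exact one_smul A _⟩
  exact ⟨m, fun a => congrArg Subtype.val (hm a), m.2⟩

/-- Glauberman's lemma, existence part, for a nilpotent group acting coprimely on a `q`-group. -/
theorem fixedPoints_nonempty_of_pretransitive {A X M : Type*} [Group A] [Finite A]
    [Group.IsNilpotent A] [MulAction A X] [Group M] [Finite M] [MulAction M X]
    [IsPretransitive M X] [Nonempty X] {q : ℕ} (hq : q.Prime) (hM : IsPGroup q M)
    (hA : ¬ q ∣ Nat.card A) (α : A →* MulAut M)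
    (hα : ∀ (a : A) (m : M) (x : X), a • m • x = α a m • a • x) :
    (fixedPoints A X).Nonempty := by
  have : Fact q.Prime := ⟨hq⟩
  refine fixedPoints_nonempty_of_normal hq ⊥ (by rwa [Subgroup.index_bot])
    ⟨Classical.arbitrary X, ?_⟩ fun K ⟨x, hx⟩ => ?_
  · rintro ⟨b, hb⟩
    rw [Subgroup.mem_bot] at hb
    subst hb
    exact one_smul A _
  · obtain ⟨k, hk⟩ := IsPGroup.iff_card.1 hM
    let S : Subgroup M := ⨅ a : K, (α a).toMonoidHom.eqLocus (MonoidHom.id M)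
    have hS : ∀ m, m ∈ S ↔ ∀ a : K, α a m = m := fun m => by
      simp only [S, Subgroup.mem_iInf]; rfl
    have horb : fixedPoints K X = orbit S x := by
      ext y
      constructor
      · intro hy
        obtain ⟨m, hm, rfl⟩ := exists_fixed_smul_eq (A := K) hq hM
          (fun h => hA (h.trans K.card_subgroup_dvd_card)) (α.comp K.subtype)
          (fun a => hα a) hx hy
        exact ⟨⟨m, (hS m).2 hm⟩, rfl⟩
      · rintro ⟨⟨m, hm⟩, rfl⟩ a
        change (a : A) • m • x = m • x
        rw [hα, (hS m).1 hm a]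
        exact congrArg _ (hx a)
    refine ⟨k, hk ▸ ?_⟩
    rw [horb, Nat.card_coe_set_eq, ← index_stabilizer]
    exact (Subgroup.index_dvd_card _).trans S.card_subgroup_dvd_card

end FixedPoints

section Cohomology

variable {N J : Type*} [Group N] [Group J]

theorem cohomologous_equivalence (φ : J →* MulAut N) : Equivalence (Cohomologous φ) where
  refl f := ⟨1, fun j => by simp⟩
  symm := by
    rintro f g ⟨n, hn⟩
    exact ⟨n⁻¹, fun j => by simp [hn, mul_assoc]⟩
  trans := by
    rintro f g h ⟨n, hn⟩ ⟨m, hm⟩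
    exact ⟨n * m, fun j => by simp [hn, hm, mul_assoc]⟩

theorem cohRel_of_quot_eq {φ : J →* MulAut N} {f g : CrossedHom φ}
    (h : Quot.mk (cohRel φ) f = Quot.mk _ g) : cohRel φ f g :=
  ((cohomologous_equivalence φ).comap Subtype.val).eqvGen_iff.1 (Quot.eqvGen_exact h)

theorem Cohomologous.map {φ : J →* MulAut N} {H : Subgroup J} {f g : H → N} {a : J}
    (ha : ∀ j : H, Commute a j) (h : Cohomologous (φ.comp H.subtype) f g) :
    Cohomologous (φ.comp H.subtype) (fun j => φ a (f j)) (fun j => φ a (g j)) := by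
  obtain ⟨n, hn⟩ := h
  refine ⟨φ a n, fun j => ?_⟩
  change φ a (g j) = (φ a n)⁻¹ * φ a (f j) * φ j (φ a n)
  rw [hn]
  change φ a (n⁻¹ * f j * φ j n) = _
  rw [map_mul, map_mul, map_inv, ← MulAut.mul_apply, ← MulAut.mul_apply, ← map_mul, ← map_mul,
    (ha j).eq]

/-- The affine action of `J` on `N` attached to two crossed homomorphisms, whose fixed points are
the elements conjugating one into the other. -/
@[reducible] def affineAction (φ : J →* MulAut N) (f g : CrossedHom φ) : MulAction J N where
  smul j n := f.1 j * φ j n * (g.1 j)⁻¹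
  one_smul n := by
    have h1 (f : CrossedHom φ) : f.1 1 = 1 := by simpa using f.2 1 1
    change f.1 1 * φ 1 n * (g.1 1)⁻¹ = n
    simp [h1]
  mul_smul j j' n := by
    change f.1 (j * j') * φ (j * j') n * (g.1 (j * j'))⁻¹
      = f.1 j * φ j (f.1 j' * φ j' n * (g.1 j')⁻¹) * (g.1 j)⁻¹
    rw [f.2, g.2]
    simp [mul_assoc]

theorem cohomologous_of_restrict [Finite N] [Finite J] [Group.IsNilpotent J] {q : ℕ}
    (hq : q.Prime) (hN : IsPGroup q N) (φ : J →* MulAut N) (f g : CrossedHom φ)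
    (P : Subgroup J) [P.Normal] (hP : ¬ q ∣ P.index)
    (h : ∃ n : N, ∀ j ∈ P, g.1 j = n⁻¹ * f.1 j * φ j n) : Cohomologous φ f.1 g.1 := by
  have hiff (j : J) (n : N) : f.1 j * φ j n * (g.1 j)⁻¹ = n ↔ g.1 j = n⁻¹ * f.1 j * φ j n := by
    rw [mul_inv_eq_iff_eq_mul, ← inv_mul_eq_iff_eq_mul, ← mul_assoc, eq_comm]
  let act : MulAction J N := affineAction φ f g
  obtain ⟨n₀, hn₀⟩ := h
  obtain ⟨n, hn⟩ := fixedPoints_nonempty_of_torsor (A := J) (T := N) hq hN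
    (fun j => ((MulAut.conj (g.1 j)).toMonoidHom.comp (φ j).toMonoidHom)) (fun t m => t * m)
    (fun t => Group.mulLeft_bijective t)
    (fun j t m => by
      change f.1 j * φ j (t * m) * (g.1 j)⁻¹
        = f.1 j * φ j t * (g.1 j)⁻¹ * (g.1 j * φ j m * (g.1 j)⁻¹)
      simp [mul_assoc])
    P hP ⟨n₀, fun j => (hiff j n₀).2 (hn₀ j j.2)⟩
  exact ⟨n, fun j => (hiff j n).1 (hn j)⟩

section Primary

variable [Finite N] [Group.IsNilpotent N]

/-- The action on a primary component of `N` induced by an action on `N`. -/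
def primaryAction (φ : J →* MulAut N) (q : ℕ) : J →* MulAut (primaryProj N q).range :=
  have h (j : J) (x : (primaryProj N q).range) : φ j x ∈ (primaryProj N q).range := by
    obtain ⟨_, y, rfl⟩ := x
    exact ⟨φ j y, primaryProj_map q (φ j) y⟩
  { toFun := fun j =>
      { toFun := fun x => ⟨φ j x, h j x⟩
        invFun := fun x => ⟨φ j⁻¹ x, h j⁻¹ x⟩
        left_inv := fun x => Subtype.ext (by simp)
        right_inv := fun x => Subtype.ext (by simp)
        map_mul' := fun x y => Subtype.ext (by simp) }
    map_one' := by ext; simp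
    map_mul' := fun a b => by ext; simp }

theorem coe_primaryAction (φ : J →* MulAut N) (q : ℕ) (j : J) (x : (primaryProj N q).range) :
    (primaryAction φ q j x : N) = φ j x := rfl

/-- The primary component of a crossed homomorphism. -/
noncomputable def CrossedHom.primary {φ : J →* MulAut N} (f : CrossedHom φ) (q : ℕ) :
    CrossedHom (primaryAction φ q) :=
  ⟨fun j => ⟨primaryProj N q (f.1 j), f.1 j, rfl⟩, fun j j' => Subtype.ext (by
    simp [f.2, coe_primaryAction, primaryProj_map])⟩

/-- Crossed homomorphisms of a finite nilpotent group are cohomologous as soon as, for each prime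
`q`, their `q`-primary components are cohomologous on a normal subgroup of index prime to `q`. -/
theorem cohomologous_of_primary [Finite J] [Group.IsNilpotent J] (φ : J →* MulAut N)
    (f g : CrossedHom φ)
    (h : ∀ q : ℕ, q.Prime → q ∣ Nat.card J → q ∣ Nat.card N → ∃ P : Subgroup J, P.Normal ∧
      ¬ q ∣ P.index ∧
      ∃ n : N, ∀ j ∈ P, primaryProj N q (g.1 j) = primaryProj N q (n⁻¹ * f.1 j * φ j n)) :
    Cohomologous φ f.1 g.1 := by
  have key : ∀ q : ℕ, ∃ m : N, q.Prime → q ∣ Nat.card N → ∀ j,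
      primaryProj N q (g.1 j) = primaryProj N q (m⁻¹ * f.1 j * φ j m) := by
    intro q
    by_cases hqN : q.Prime ∧ q ∣ Nat.card N
    · obtain ⟨hq, hqN⟩ := hqN
      obtain ⟨P, hPn, hPi, n, hn⟩ : ∃ P : Subgroup J, P.Normal ∧ ¬ q ∣ P.index ∧
          ∃ n : N, ∀ j ∈ P,
            primaryProj N q (g.1 j) = primaryProj N q (n⁻¹ * f.1 j * φ j n) := by
        by_cases hqJ : q ∣ Nat.card J
        · exact h q hq hqJ hqN
        · refine ⟨⊥, inferInstance, by rwa [Subgroup.index_bot], 1, fun j hj => ?_⟩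
          have h1 (f : CrossedHom φ) : f.1 1 = 1 := by simpa using f.2 1 1
          rw [Subgroup.mem_bot] at hj
          simp [hj, h1]
      obtain ⟨m, hm⟩ := cohomologous_of_restrict hq (isPGroup_range_primaryProj hq)
        (primaryAction φ q) (f.primary q) (g.primary q) P hPi
        ⟨⟨primaryProj N q n, n, rfl⟩, fun j hj => Subtype.ext (by
          simpa [CrossedHom.primary, coe_primaryAction, primaryProj_map] using hn j hj)⟩
      have hmm : primaryProj N q m = m := by
        obtain ⟨y, hy⟩ := m.2
        rw [← hy, primaryProj_idem hq]
      refine ⟨m, fun _ _ j => ?_⟩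
      have := congrArg Subtype.val (hm j)
      simpa [CrossedHom.primary, coe_primaryAction, primaryProj_map, hmm] using this
    · exact ⟨1, fun hq hqN' => absurd ⟨hq, hqN'⟩ hqN⟩
  choose m hm using key
  obtain ⟨n, hn⟩ := exists_primaryProj_eq m
  refine ⟨n, fun j => eq_of_primaryProj_eq fun q hq hqN => ?_⟩
  rw [hm q hq hqN j]
  simp [primaryProj_map, hn q hq hqN]

end Primary

/-- An invariant class on a Sylow subgroup extends to the whole group. -/
theorem exists_extension [Finite N] [Finite J] [Group.IsNilpotent J] {q : ℕ}
    [hq : Fact q.Prime] (hN : IsPGroup q N) (φ : J →* MulAut N) (P : Sylow q J)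
    (g : CrossedHom (φ.comp (P : Subgroup J).subtype))
    (hg : ∀ a : J, (orderOf a).Coprime q →
      Cohomologous (φ.comp (P : Subgroup J).subtype) (fun x => φ a (g.1 x)) g.1) :
    ∃ f : CrossedHom φ, Cohomologous (φ.comp (P : Subgroup J).subtype) g.1 (fun x => f.1 x) := by
  let φP := φ.comp (P : Subgroup J).subtype
  let A := (primaryProj J q).ker
  have hAP (a : A) (x : (P : Subgroup J)) : Commute (a : J) x :=
    (commute_of_primaryProj hq.out ((mem_sylow_iff_primaryProj_eq P).1 x.2) a.2).symm
  have hAPφ (a : A) (x : (P : Subgroup J)) (n : N) : φ a (φP x n) = φP x (φ a n) := by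
    change φ a (φ x n) = φ x (φ a n)
    rw [← MulAut.mul_apply, ← MulAut.mul_apply, ← map_mul, ← map_mul, (hAP a x).eq]
  have hAcard : ¬ q ∣ Nat.card A := not_dvd_card_ker_primaryProj hq.out
  have hAcop (a : A) : (orderOf (a : J)).Coprime q := by
    rw [Subgroup.orderOf_coe]
    exact ((hq.out.coprime_iff_not_dvd.2 fun h => hAcard (h.trans (orderOf_dvd_natCard a)))).symm
  have hinv (a : A) {h : ↥(P : Subgroup J) → N} (hh : Cohomologous φP g.1 h) :
      Cohomologous φP g.1 (fun x => φ a (h x)) := by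
    exact (cohomologous_equivalence φP).trans
      ((cohomologous_equivalence φP).symm (hg a (hAcop a))) (hh.map (hAP a))
  let X := {h : ↥(P : Subgroup J) → N // Cohomologous φP g.1 h}
  let actA : MulAction A X :=
    { smul := fun a h => ⟨fun x => φ a (h.1 x), hinv a h.2⟩
      one_smul := fun h => Subtype.ext (by
        funext x; change φ 1 (h.1 x) = h.1 x; simp)
      mul_smul := fun a b h => Subtype.ext (by
        funext x; change φ (a * b : J) (h.1 x) = φ a (φ b (h.1 x)); simp) }
  let actN : MulAction N X :=
    { smul := fun n h => ⟨fun x => n * h.1 x * (φP x n)⁻¹,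
        (cohomologous_equivalence φP).trans h.2 ⟨n⁻¹, fun x => by simp⟩⟩
      one_smul := fun h => Subtype.ext (by
        funext x; change 1 * h.1 x * (φP x 1)⁻¹ = h.1 x; simp)
      mul_smul := fun n m h => Subtype.ext (by
        funext x
        change n * m * h.1 x * (φP x (n * m))⁻¹ = n * (m * h.1 x * (φP x m)⁻¹) * (φP x n)⁻¹
        simp [mul_assoc]) }
  have : IsPretransitive N X := ⟨fun h h' => by
    obtain ⟨n, hn⟩ := (cohomologous_equivalence φP).trans
      ((cohomologous_equivalence φP).symm h.2) h'.2
    refine ⟨n⁻¹, Subtype.ext (funext fun x => ?_)⟩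
    change n⁻¹ * h.1 x * (φP x n⁻¹)⁻¹ = h'.1 x
    rw [hn]; simp⟩
  have : Nonempty X := ⟨⟨g.1, (cohomologous_equivalence φP).refl _⟩⟩
  obtain ⟨⟨h, hh⟩, hfix⟩ := fixedPoints_nonempty_of_pretransitive (A := A) (X := X) hq.out hN hAcard
    (φ.comp A.subtype) (fun a n h => Subtype.ext (funext fun x => by
      change φ a (n * h.1 x * (φP x n)⁻¹) = φ a n * φ a (h.1 x) * (φP x (φ a n))⁻¹
      simp [hAPφ]))
  have hfix' (a : A) (x : (P : Subgroup J)) : φ a (h x) = h x :=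
    congrFun (congrArg Subtype.val (hfix a)) x
  have hcross (x y : (P : Subgroup J)) : h (x * y) = h x * φP x (h y) := by
    obtain ⟨n, hn⟩ := hh
    have hg' : g.1 (x * y) = g.1 x * φP x (g.1 y) := g.2 x y
    simp [hn, hg', mul_assoc]
  let pr (j : J) : (P : Subgroup J) :=
    ⟨primaryProj J q j, (mem_sylow_iff_primaryProj_eq P).2 (primaryProj_idem hq.out j)⟩
  have hpr (j j' : J) : pr (j * j') = pr j * pr j' := Subtype.ext (map_mul _ _ _)
  refine ⟨⟨fun j => h (pr j), fun j j' => ?_⟩, ?_⟩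
  · have hmem : (primaryProj J q j)⁻¹ * j ∈ A := by
      rw [MonoidHom.mem_ker, map_mul, map_inv, primaryProj_idem hq.out, inv_mul_cancel]
    have hj : φ j (h (pr j')) = φP (pr j) (h (pr j')) := by
      conv_rhs => rw [← hfix' ⟨_, hmem⟩]
      change _ = φ (primaryProj J q j) _
      rw [← MulAut.mul_apply, ← map_mul, mul_inv_cancel_left]
    change h (pr (j * j')) = h (pr j) * φ j (h (pr j'))
    rw [hpr, hcross, hj]
  · have hprP (x : (P : Subgroup J)) : pr x = x :=
      Subtype.ext ((mem_sylow_iff_primaryProj_eq P).1 x.2)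
    simpa only [hprP] using hh

/-- The restriction of a crossed homomorphism to a subgroup. -/
def CrossedHom.restrict {φ : J →* MulAut N} (f : CrossedHom φ) (H : Subgroup J) :
    CrossedHom (φ.comp H.subtype) :=
  ⟨fun x => f.1 x, fun x y => f.2 x y⟩

theorem CrossedHom.cohomologous_map_restrict {φ : J →* MulAut N} (f : CrossedHom φ)
    {H : Subgroup J} {a : J} (ha : ∀ j : H, Commute a j) :
    Cohomologous (φ.comp H.subtype) (fun x => φ a ((f.restrict H).1 x)) (f.restrict H).1 := by
  refine (cohomologous_equivalence _).symm ⟨f.1 a, fun x => ?_⟩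
  change φ a (f.1 x) = (f.1 a)⁻¹ * f.1 x * φ x (f.1 a)
  rw [mul_assoc, ← f.2, ← (ha x).eq, f.2, inv_mul_cancel_left]

/-- An invariant class on a Sylow `q`-subgroup extends, after projection to the `q`-primary
component of the coefficients. -/
theorem exists_primary_extension [Finite N] [Group.IsNilpotent N] [Finite J]
    [Group.IsNilpotent J] {q : ℕ} [hq : Fact q.Prime] (φ : J →* MulAut N) (P : Sylow q J)
    (g : CrossedHom (φ.comp (P : Subgroup J).subtype))
    (hg : ∀ a : J, (orderOf a).Coprime q →
      Cohomologous (φ.comp (P : Subgroup J).subtype) (fun x => φ a (g.1 x)) g.1) :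
    ∃ f : CrossedHom (primaryAction φ q), ∃ n : N, ∀ x : (P : Subgroup J),
      primaryProj N q (g.1 x) = primaryProj N q (n⁻¹ * f.1 x * φ x n) := by
  obtain ⟨f, hf⟩ := exists_extension (isPGroup_range_primaryProj hq.out) (primaryAction φ q) P
    (g.primary q) (fun a ha => by
      obtain ⟨n, hn⟩ := hg a ha
      refine ⟨⟨primaryProj N q n, n, rfl⟩, fun x => Subtype.ext ?_⟩
      have := congrArg (primaryProj N q) (hn x)
      simpa [CrossedHom.primary, coe_primaryAction, primaryProj_map] using this)
  obtain ⟨n, hn⟩ := (cohomologous_equivalence _).symm hf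
  have hidem (m : (primaryProj N q).range) : primaryProj N q m = m := by
    obtain ⟨y, hy⟩ := m.2
    rw [← hy, primaryProj_idem hq.out]
  refine ⟨f, n, fun x => ?_⟩
  have := congrArg Subtype.val (hn x)
  simpa [CrossedHom.primary, coe_primaryAction, primaryProj_map, hidem] using this

theorem exists_crossedHom_primary [Finite N] [Group.IsNilpotent N] (φ : J →* MulAut N)
    (F : ∀ q : ℕ, CrossedHom (primaryAction φ q)) :
    ∃ f : CrossedHom φ, ∀ q : ℕ, q.Prime → q ∣ Nat.card N → ∀ j,
      primaryProj N q (f.1 j) = (F q).1 j := by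
  choose f hf using fun j => exists_primaryProj_eq fun q => ((F q).1 j : N)
  have hf' (q : ℕ) (hq : q.Prime) (hqN : q ∣ Nat.card N) (j : J) :
      primaryProj N q (f j) = (F q).1 j := by
    rw [hf j q hq hqN]
    obtain ⟨y, hy⟩ := ((F q).1 j).2
    rw [← hy, primaryProj_idem hq]
  refine ⟨⟨f, fun j j' => eq_of_primaryProj_eq fun q hq hqN => ?_⟩, hf'⟩
  rw [map_mul, primaryProj_map, hf' q hq hqN, hf' q hq hqN, hf' q hq hqN, (F q).2,
    Subgroup.coe_mul, coe_primaryAction]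

end Cohomology

/-- (Lemma 1.) For finite nilpotent `J`, `N` with `J` acting on `N` by automorphisms,
restriction `φ ↦ (φ|_{J_p})_{p ∈ D}` induces an isomorphism of pointed sets
`H¹(J, N) ≅ ∏_{p ∈ D} H¹(J_p, N)^{J'_p}`, where `D` is the set of primes dividing
both `|J|` and `|N|`, `J_p` is the Sylow `p`-subgroup of `J`, and the `J'_p`-invariant
classes are those fixed under the action of every element of `J` of order prime
to `p` (i.e. of the Hall `p'`-subgroup `J'_p` of the nilpotent group `J`). -/
theorem stmt_10 {N J : Type*} [Group N] [Group J] [Finite N] [Finite J]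
    [Group.IsNilpotent N] [Group.IsNilpotent J]
    (φ : J →* MulAut N)
    (Jp : ∀ p : {p : ℕ // p.Prime ∧ p ∣ Nat.card J ∧ p ∣ Nat.card N}, Sylow p.1 J) :
    ∃ e : Quot (cohRel φ) ≃
        (∀ p : {p : ℕ // p.Prime ∧ p ∣ Nat.card J ∧ p ∣ Nat.card N},
          {c : Quot (cohRel (φ.comp ((Jp p : Subgroup J).subtype))) //
            ∀ g : CrossedHom (φ.comp ((Jp p : Subgroup J).subtype)),
              Quot.mk _ g = c → ∀ j' : J, Nat.Coprime (orderOf j') p.1 →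
                Cohomologous (φ.comp ((Jp p : Subgroup J).subtype))
                  (fun x => φ j' (g.1 x)) g.1}),
      ∀ (f : CrossedHom φ)
        (p : {p : ℕ // p.Prime ∧ p ∣ Nat.card J ∧ p ∣ Nat.card N})
        (g : CrossedHom (φ.comp ((Jp p : Subgroup J).subtype))),
        (∀ x : (Jp p : Subgroup J), g.1 x = f.1 x) →
        (e (Quot.mk _ f) p).1 = Quot.mk _ g := by
  have hcomm (p : {p : ℕ // p.Prime ∧ p ∣ Nat.card J ∧ p ∣ Nat.card N}) (a : J)
      (ha : (orderOf a).Coprime p.1) (x : (Jp p : Subgroup J)) : Commute a x := by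
    have : Fact p.1.Prime := ⟨p.2.1⟩
    exact (commute_of_primaryProj p.2.1 ((mem_sylow_iff_primaryProj_eq (Jp p)).1 x.2)
      (primaryProj_eq_one_of_coprime p.2.1 ha)).symm
  let res : Quot (cohRel φ) →
      (∀ p : {p : ℕ // p.Prime ∧ p ∣ Nat.card J ∧ p ∣ Nat.card N},
          {c : Quot (cohRel (φ.comp ((Jp p : Subgroup J).subtype))) //
            ∀ g : CrossedHom (φ.comp ((Jp p : Subgroup J).subtype)),
              Quot.mk _ g = c → ∀ j' : J, Nat.Coprime (orderOf j') p.1 →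
                Cohomologous (φ.comp ((Jp p : Subgroup J).subtype))
                  (fun x => φ j' (g.1 x)) g.1}) :=
    fun c p => ⟨Quot.map (fun f => f.restrict (Jp p))
      (fun f f' ⟨n, hn⟩ => ⟨n, fun x => hn x⟩) c, by
        induction c using Quot.ind with | _ f
        intro g hg a ha
        have hgf : Cohomologous _ g.1 (f.restrict (Jp p)).1 := cohRel_of_quot_eq hg
        exact (cohomologous_equivalence _).trans (hgf.map (hcomm p a ha))
          ((cohomologous_equivalence _).trans (f.cohomologous_map_restrict (hcomm p a ha))
            ((cohomologous_equivalence _).symm hgf))⟩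
  have hinj : Function.Injective res := by
    intro c c' h
    induction c using Quot.ind with | _ f
    induction c' using Quot.ind with | _ f'
    refine Quot.sound (cohomologous_of_primary φ f f' fun q hq hqJ hqN => ?_)
    have : Fact q.Prime := ⟨hq⟩
    let p : {p : ℕ // p.Prime ∧ p ∣ Nat.card J ∧ p ∣ Nat.card N} := ⟨q, hq, hqJ, hqN⟩
    obtain ⟨n, hn⟩ := cohRel_of_quot_eq (congrArg Subtype.val (congrFun h p))
    exact ⟨Jp p, inferInstanceAs (Sylow.toSubgroup (p := q) (Jp p)).Normal,
      Sylow.not_dvd_index (p := q) (Jp p), n, fun j hj => congrArg _ (hn ⟨j, hj⟩)⟩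
  have hsurj : Function.Surjective res := by
    intro c
    choose g hg using fun p => Quot.exists_rep (c p).1
    have hext (q : ℕ) : ∃ F : CrossedHom (primaryAction φ q),
        ∀ h : q.Prime ∧ q ∣ Nat.card J ∧ q ∣ Nat.card N, ∃ n : N,
          ∀ x : (Jp ⟨q, h⟩ : Subgroup J), primaryProj N q ((g ⟨q, h⟩).1 x)
            = primaryProj N q (n⁻¹ * F.1 x * φ x n) := by
      by_cases h : q.Prime ∧ q ∣ Nat.card J ∧ q ∣ Nat.card N
      · have : Fact q.Prime := ⟨h.1⟩
        obtain ⟨F, hF⟩ := exists_primary_extension φ (Jp ⟨q, h⟩) (g ⟨q, h⟩)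
          ((c ⟨q, h⟩).2 _ (hg ⟨q, h⟩))
        exact ⟨F, fun _ => hF⟩
      · exact ⟨⟨1, by simp⟩, fun h' => absurd h' h⟩
    choose F hF using hext
    obtain ⟨f, hf⟩ := exists_crossedHom_primary φ F
    refine ⟨Quot.mk _ f, funext fun p => Subtype.ext ?_⟩
    rw [← hg p]
    refine Quot.sound (cohomologous_of_primary _ (f.restrict (Jp p)) (g p)
      fun q hq hqJ hqN => ?_)
    have : Fact p.1.Prime := ⟨p.2.1⟩
    have hqp : q = p.1 := by
      obtain ⟨k, hk⟩ := IsPGroup.iff_card.1 (Jp p).isPGroup'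
      exact (Nat.prime_dvd_prime_iff_eq hq p.2.1).1 (hq.dvd_of_dvd_pow (hk ▸ hqJ))
    obtain ⟨p, hp⟩ := p
    subst hqp
    obtain ⟨n, hn⟩ := hF q hp
    refine ⟨⊤, inferInstance, by simpa using hq.one_lt.ne', n, fun x _ => ?_⟩
    have hidem : primaryProj N q ((F q).1 x) = (F q).1 x := by
      rw [← hf q hq hqN, primaryProj_idem hq]
    rw [hn x]
    change _ = primaryProj N q (n⁻¹ * f.1 x * φ x n)
    rw [map_mul, map_mul, map_mul, map_mul, hf q hq hqN, hidem]
  refine ⟨Equiv.ofBijective res ⟨hinj, hsurj⟩, fun f p g hg => ?_⟩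
  change Quot.mk _ (f.restrict (Jp p)) = Quot.mk _ g
  exact congrArg _ (Subtype.ext (funext fun x => (hg x).symm))
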